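/- arXiv:1906.09501 — 2 statements merged into one kernel-verified Lean document; each statement's English description precedes it below -/
import Mathlib

section
/- Let G be a connected graph on vertex set [n], let Σ ∈ M(G) be generic, let A, B ⊆ [n] be nonempty, and set r = rank(Σ_{A,B}). Then a vertex v ∈ [n] lies in some minimal separator of A and B in G if and only if rank(Σ_{A∪{v}, B∪{v}}) = r. -/
open SimpleGraph

/-- `S` separates `A` and `B` in `G`: every walk from a vertex of `A` to a vertex of `B`
passes through a vertex of `S`. -/
def Separates {n : ℕ} (G : SimpleGraph (Fin n)) (A B S : Finset (Fin n)) : Prop :=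
  ∀ a ∈ A, ∀ b ∈ B, ∀ p : G.Walk a b, ∃ s ∈ p.support, s ∈ S

/-- A minimal separator of `A` and `B`: a separator of minimum cardinality. -/
def IsMinimalSeparator {n : ℕ} (G : SimpleGraph (Fin n)) (A B S : Finset (Fin n)) : Prop :=
  Separates G A B S ∧ ∀ S' : Finset (Fin n), Separates G A B S' → S.card ≤ S'.card

/-- The submatrix of `S` with rows indexed by `A` and columns indexed by `B`. -/
def subm {n : ℕ} (S : Matrix (Fin n) (Fin n) ℝ) (A B : Finset (Fin n)) :
    Matrix A B ℝ :=
  S.submatrix (fun a : A => (a : Fin n)) (fun b : B => (b : Fin n))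

/-- `S` is generic for `G`: the rank of every submatrix `S_{A,B}` equals the minimum
size of a separator of `A` and `B` in `G`. -/
def IsGeneric {n : ℕ} (G : SimpleGraph (Fin n)) (S : Matrix (Fin n) (Fin n) ℝ) : Prop :=
  ∀ A B : Finset (Fin n),
    (subm S A B).rank = sInf {k : ℕ | ∃ S' : Finset (Fin n), Separates G A B S' ∧ S'.card = k}

theorem Separates.mono {n : ℕ} {G : SimpleGraph (Fin n)} {A A' B B' T : Finset (Fin n)}
    (h : Separates G A' B' T) (hA : A ⊆ A') (hB : B ⊆ B') : Separates G A B T :=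
  fun a ha b hb p => h a (hA ha) b (hB hb) p

theorem Separates.union_singleton {n : ℕ} {G : SimpleGraph (Fin n)} {A B T : Finset (Fin n)}
    {v : Fin n} (h : Separates G A B T) (hv : v ∈ T) : Separates G (A ∪ {v}) (B ∪ {v}) T := by
  intro a ha b hb p
  rcases Finset.mem_union.1 ha with ha | ha
  · rcases Finset.mem_union.1 hb with hb | hb
    · exact h a ha b hb p
    · exact ⟨b, p.end_mem_support, by rwa [Finset.mem_singleton.1 hb]⟩
  · exact ⟨a, p.start_mem_support, by rwa [Finset.mem_singleton.1 ha]⟩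

theorem Separates.inter_subset {n : ℕ} {G : SimpleGraph (Fin n)} {A B T : Finset (Fin n)}
    (h : Separates G A B T) : A ∩ B ⊆ T := by
  intro v hv
  obtain ⟨hvA, hvB⟩ := Finset.mem_inter.1 hv
  obtain ⟨s, hs, hsT⟩ := h v hvA v hvB Walk.nil
  rw [Walk.support_nil, List.mem_singleton] at hs
  rwa [← hs]

theorem separates_univ {n : ℕ} (G : SimpleGraph (Fin n)) (A B : Finset (Fin n)) :
    Separates G A B Finset.univ :=
  fun a _ _ _ p => ⟨a, p.start_mem_support, Finset.mem_univ a⟩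

theorem IsGeneric.rank_le_card {n : ℕ} {G : SimpleGraph (Fin n)} {S : Matrix (Fin n) (Fin n) ℝ}
    (hgen : IsGeneric G S) {A B T : Finset (Fin n)} (h : Separates G A B T) :
    (subm S A B).rank ≤ T.card := by
  rw [hgen A B]
  exact Nat.sInf_le ⟨T, h, rfl⟩

theorem IsGeneric.exists_separates_card_eq_rank {n : ℕ} {G : SimpleGraph (Fin n)}
    {S : Matrix (Fin n) (Fin n) ℝ} (hgen : IsGeneric G S) (A B : Finset (Fin n)) :
    ∃ T : Finset (Fin n), Separates G A B T ∧ T.card = (subm S A B).rank := by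
  rw [hgen A B]
  exact Nat.sInf_mem (s := {k : ℕ | ∃ T : Finset (Fin n), Separates G A B T ∧ T.card = k})
    ⟨_, Finset.univ, separates_univ G A B, rfl⟩

/-- For a connected graph `G` on `[n]`, a generic `S ∈ M(G)`, and nonempty
`A, B ⊆ [n]` with `r = rank S_{A,B}`: a vertex `v` lies in some minimal separator of `A` and
`B` in `G` if and only if `rank S_{A∪{v},B∪{v}} = r`. -/
theorem mem_minimal_separator_iff_rank {n : ℕ} (G : SimpleGraph (Fin n))
    (hG : G.Connected) (S : Matrix (Fin n) (Fin n) ℝ) (hpd : S.PosDef) (hsymm : S.IsSymm)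
    (hM : ∀ i j : Fin n, i ≠ j → ¬ G.Adj i j → S⁻¹ i j = 0)
    (hgen : IsGeneric G S)
    (A B : Finset (Fin n)) (hA : A.Nonempty) (hB : B.Nonempty)
    (r : ℕ) (hr : r = (subm S A B).rank) (v : Fin n) :
    (∃ S' : Finset (Fin n), IsMinimalSeparator G A B S' ∧ v ∈ S') ↔
      (subm S (A ∪ {v}) (B ∪ {v})).rank = r := by
  subst hr
  obtain ⟨T, hT, hTcard⟩ := hgen.exists_separates_card_eq_rank (A ∪ {v}) (B ∪ {v})
  have hT' : Separates G A B T := hT.mono Finset.subset_union_left Finset.subset_union_left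
  constructor
  · rintro ⟨S', ⟨hS', hmin⟩, hv⟩
    obtain ⟨U, hU, hUcard⟩ := hgen.exists_separates_card_eq_rank A B
    refine le_antisymm ?_ (hTcard ▸ hgen.rank_le_card hT')
    exact (hgen.rank_le_card (hS'.union_singleton hv)).trans (hUcard ▸ hmin U hU)
  · intro h
    refine ⟨T, ⟨hT', fun U hU => ?_⟩, hT.inter_subset (by simp)⟩
    rw [hTcard, h]
    exact hgen.rank_le_card hU
end

section
/- Let G = (V, E) be a graph with treewidth tw(G) ≤ k, and let W ⊆ V be a δ-sample for 𝓕_{k+1} with |W| ≥ 6(k+1) and δ ≤ 1/24. Then: (i) W can be partitioned into two sets A and B with |A| ≤ (2/3)|W| and |B| ≤ (2/3)|W| such that every minimal separator S of A and B in G has |S| ≤ k+1; and (ii) for any partition of W into sets A, B with |A|, |B| ≤ (2/3)|W| and any separator S of A and B in G with |S| ≤ k+1, max(|A ∖ S|, |B ∖ S|) ≤ (4/5)|W ∖ S|. -/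
open SimpleGraph

variable {V : Type*}

/-- `u` and `w` are connected by a walk in `G` avoiding the set `S`
(i.e. they lie in the same connected component of `G ∖ S`). -/
def ReachAvoid (G : SimpleGraph V) (S : Set V) (u w : V) : Prop :=
  ∃ p : G.Walk u w, ∀ x ∈ p.support, x ∉ S

/-- The connected component of `v` in `G ∖ S` (as a set of vertices). -/
def compAvoid (G : SimpleGraph V) (S : Set V) (v : V) : Set V :=
  {w | ReachAvoid G S v w}

/-- The set `𝒞^S` of connected components of `G ∖ S`. -/
def comps (G : SimpleGraph V) (S : Set V) : Set (Set V) :=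
  {C | ∃ v, v ∉ S ∧ C = compAvoid G S v}

/-- The size of the largest connected component of `G ∖ S`. -/
noncomputable def maxComp [Fintype V] (G : SimpleGraph V) (S : Set V) : ℕ :=
  sSup {k : ℕ | ∃ C ∈ comps G S, k = C.ncard}

/-- The centrality `c(S) = (1/|V ∖ S|) · max_{C ∈ 𝒞^S} |C|`. -/
noncomputable def cent [Fintype V] (G : SimpleGraph V) (S : Set V) : ℝ :=
  (maxComp G S : ℝ) / ((Sᶜ : Set V).ncard : ℝ)

/-- The family `𝓕_k`: all sets that are a connected component of `G ∖ S` for some `S` with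
`|S| ≤ k`, or the union of all but one of the connected components of such a `G ∖ S`. -/
def family (G : SimpleGraph V) (k : ℕ) : Set (Set V) :=
  {C | ∃ S : Set V, S.ncard ≤ k ∧
    (C ∈ comps G S ∨ ∃ C₀ ∈ comps G S, C = ⋃₀ (comps G S \ {C₀}))}

/-- `W` is a `δ`-sample for `𝓕_k`: for every `C ∈ 𝓕_k`,
`|C|/|V| − δ ≤ |W ∩ C|/|W| ≤ |C|/|V| + δ`. -/
def IsDeltaSample [Fintype V] (G : SimpleGraph V) (k : ℕ) (δ : ℝ) (W : Set V) : Prop :=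
  ∀ C ∈ family G k,
    (C.ncard : ℝ) / (Fintype.card V : ℝ) - δ ≤ ((W ∩ C).ncard : ℝ) / (W.ncard : ℝ) ∧
      ((W ∩ C).ncard : ℝ) / (W.ncard : ℝ) ≤ (C.ncard : ℝ) / (Fintype.card V : ℝ) + δ

/-- `S` separates `A` and `B` in `G`: every walk from a vertex of `A` to a vertex of `B`
passes through a vertex of `S`. -/
def SeparatesSet (G : SimpleGraph V) (A B S : Set V) : Prop :=
  ∀ a ∈ A, ∀ b ∈ B, ∀ p : G.Walk a b, ∃ s ∈ p.support, s ∈ S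

/-- A minimal separator of `A` and `B`: a separator of minimum cardinality. -/
def IsMinSepSet (G : SimpleGraph V) (A B S : Set V) : Prop :=
  SeparatesSet G A B S ∧ ∀ S' : Set V, SeparatesSet G A B S' → S.ncard ≤ S'.ncard

/-- `G` has treewidth at most `k`: there is a tree decomposition of `G` all of whose bags
have at most `k+1` vertices. -/
def HasTreewidthLE (G : SimpleGraph V) (k : ℕ) : Prop :=
  ∃ (m : ℕ) (T : SimpleGraph (Fin m)) (Bag : Fin m → Set V),
    T.IsTree ∧
    (∀ v : V, ∃ i, v ∈ Bag i) ∧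
    (∀ u v : V, G.Adj u v → ∃ i, u ∈ Bag i ∧ v ∈ Bag i) ∧
    (∀ (v : V) (i j : Fin m), v ∈ Bag i → v ∈ Bag j →
      ∀ p : T.Path i j, ∀ x ∈ (p : T.Walk i j).support, v ∈ Bag x) ∧
    (∀ i, (Bag i).ncard ≤ k + 1)

lemma ReachAvoid.symm {G : SimpleGraph V} {S : Set V} {u v : V}
    (h : ReachAvoid G S u v) : ReachAvoid G S v u := by
  obtain ⟨p, hp⟩ := h
  exact ⟨p.reverse, by simpa using hp⟩

lemma ReachAvoid.trans {G : SimpleGraph V} {S : Set V} {u v w : V}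
    (h : ReachAvoid G S u v) (h' : ReachAvoid G S v w) : ReachAvoid G S u w := by
  obtain ⟨p, hp⟩ := h
  obtain ⟨q, hq⟩ := h'
  refine ⟨p.append q, fun x hx => ?_⟩
  rcases (SimpleGraph.Walk.mem_support_append_iff p q).1 hx with hx | hx
  exacts [hp x hx, hq x hx]

lemma ReachAvoid.refl {G : SimpleGraph V} {S : Set V} {v : V} (h : v ∉ S) :
    ReachAvoid G S v v :=
  ⟨.nil, by simpa using h⟩

lemma compAvoid_eq_of_reachAvoid {G : SimpleGraph V} {S : Set V} {u v : V}
    (h : ReachAvoid G S u v) : compAvoid G S u = compAvoid G S v :=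
  Set.ext fun _ => ⟨h.symm.trans, h.trans⟩

/-- Deleting an edge of a forest leaves no vertex on both sides of that edge. -/
lemma SimpleGraph.IsAcyclic.not_reachAvoid_both {T : SimpleGraph V} (hT : T.IsAcyclic)
    {i j t : V} (hij : T.Adj i j) (hj : ReachAvoid T {i} j t) (hi : ReachAvoid T {j} i t) :
    False := by
  classical
  obtain ⟨p, hp⟩ := hj
  obtain ⟨q, hq⟩ := hi
  have hq' : j ∉ q.toPath.1.support := fun h => hq j (q.support_toPath_subset_support h) rfl
  have hp' : i ∉ p.toPath.1.support := fun h => hp i (p.support_toPath_subset_support h) rfl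
  have := hT.subsingleton_path j t
  have h := Subsingleton.elim p.toPath
    ⟨.cons hij.symm q.toPath.1, (SimpleGraph.Walk.cons_isPath_iff _ _).2 ⟨q.toPath.2, hq'⟩⟩
  apply hp'
  rw [h]
  simp

/-- In a tree decomposition, a connected component outside the bag of `i` lives in a single
branch of the tree at `i`. -/
lemma exists_adj_forall_compAvoid_reachAvoid {ι : Type*} {G : SimpleGraph V}
    {T : SimpleGraph ι} {Bag : ι → Set V} (hT : T.IsTree) (hcov : ∀ v : V, ∃ i, v ∈ Bag i)
    (hedge : ∀ u v : V, G.Adj u v → ∃ i, u ∈ Bag i ∧ v ∈ Bag i)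
    (hconn : ∀ (v : V) (i j : ι), v ∈ Bag i → v ∈ Bag j →
      ∀ p : T.Path i j, ∀ x ∈ (p : T.Walk i j).support, v ∈ Bag x)
    {i : ι} {v : V} (hv : v ∉ Bag i) :
    ∃ j, T.Adj i j ∧ ∀ w ∈ compAvoid G (Bag i) v, ∀ t, w ∈ Bag t → ReachAvoid T {i} j t := by
  classical
  have hstep : ∀ w, w ∉ Bag i → ∀ s t, w ∈ Bag s → w ∈ Bag t → ReachAvoid T {i} s t := by
    intro w hw s t hs ht
    obtain ⟨p⟩ := hT.connected s t
    refine ⟨p.toPath.1, fun x hx hxi => hw ?_⟩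
    rw [Set.mem_singleton_iff] at hxi
    exact hxi ▸ hconn w s t hs ht p.toPath x hx
  obtain ⟨t₀, ht₀⟩ := hcov v
  obtain ⟨p, hp⟩ := (hT.connected i t₀).exists_isPath
  cases p with
  | nil => exact absurd ht₀ hv
  | @cons _ j _ hij q =>
    rw [SimpleGraph.Walk.cons_isPath_iff] at hp
    have hjt₀ : ReachAvoid T {i} j t₀ :=
      ⟨q, fun x hx hxi => hp.2 (by rw [Set.mem_singleton_iff] at hxi; exact hxi ▸ hx)⟩
    have hprop : ∀ {u w : V} (r : G.Walk u w), (∀ x ∈ r.support, x ∉ Bag i) →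
        (∀ t, u ∈ Bag t → ReachAvoid T {i} j t) → ∀ t, w ∈ Bag t → ReachAvoid T {i} j t := by
      intro u w r
      induction r with
      | nil => exact fun _ h => h
      | @cons a b c hab r ih =>
        intro hr ha
        refine ih (fun x hx => hr x (by simp [hx])) fun t ht => ?_
        obtain ⟨s, has, hbs⟩ := hedge a b hab
        exact (ha s has).trans (hstep b (hr b (by simp)) s t hbs ht)
    refine ⟨j, hij, ?_⟩
    rintro w ⟨r, hr⟩
    exact hprop r hr fun t ht => hjt₀.trans (hstep v hv t₀ t ht₀ ht)

/-- A graph of treewidth at most `k` has, for every vertex set `W`, a separator of size at most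
`k + 1` all of whose components contain at most half of `W`. -/
lemma HasTreewidthLE.exists_balanced_separator [Finite V] {G : SimpleGraph V} {k : ℕ}
    (htw : HasTreewidthLE G k) (W : Set V) :
    ∃ X : Set V, X.ncard ≤ k + 1 ∧
      ∀ v, v ∉ X → 2 * (W ∩ compAvoid G X v).ncard ≤ W.ncard := by
  classical
  obtain ⟨m, T, Bag, hT, hcov, hedge, hconn, hsize⟩ := htw
  by_contra! hbad
  choose c hc hcW using fun i => hbad (Bag i) (hsize i)
  choose f hf hfc using fun i =>
    exists_adj_forall_compAvoid_reachAvoid hT hcov hedge hconn (hc i)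
  have hcard := hT.card_edgeFinset
  obtain ⟨i, -, j, -, hij, he⟩ := Finset.exists_ne_map_eq_of_card_lt_of_maps_to
    (s := Finset.univ) (t := T.edgeFinset) (f := fun i => s(i, f i))
    (by rw [Finset.card_univ]; omega) (fun i _ => by simpa using hf i)
  obtain ⟨h₁, h₂⟩ : i = f j ∧ f i = j := by
    rcases Sym2.eq_iff.1 he with h | h
    exacts [absurd h.1 hij, h]
  obtain ⟨v, hvi, hvj⟩ : ((W ∩ compAvoid G (Bag i) (c i)) ∩
      (W ∩ compAvoid G (Bag j) (c j))).Nonempty := by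
    by_contra hne
    have hunion := Set.ncard_union_eq (Set.disjoint_iff_inter_eq_empty.2
      (Set.not_nonempty_iff_eq_empty.1 hne)) (Set.toFinite _) (Set.toFinite _)
    have hle := Set.ncard_le_ncard (Set.union_subset
      (Set.inter_subset_left (s := W) (t := compAvoid G (Bag i) (c i)))
      (Set.inter_subset_left (s := W) (t := compAvoid G (Bag j) (c j)))) (Set.toFinite W)
    have hi := hcW i
    have hj := hcW j
    omega
  obtain ⟨t, ht⟩ := hcov v
  refine hT.isAcyclic.not_reachAvoid_both (i := i) (j := j) (t := t) (h₂ ▸ hf i) ?_ ?_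
  · simpa [h₂] using hfc i v hvi.2 t ht
  · simpa [← h₁] using hfc j v hvj.2 t ht

/-- If every fibre of `ℓ` covers at most half of `W`, some union of fibres covers between one
third and two thirds of `W`. -/
lemma Finset.exists_card_filter_mem_between_thirds {α β : Type*} [DecidableEq β]
    (W : Finset α) (ℓ : α → β) (h : ∀ b, 2 * (W.filter (ℓ · = b)).card ≤ W.card) :
    ∃ P : Finset β, W.card ≤ 3 * (W.filter (ℓ · ∈ P)).card ∧
      3 * (W.filter (ℓ · ∈ P)).card ≤ 2 * W.card := by
  classical
  have hex : ∃ P : Finset β, W.card ≤ 3 * (W.filter (ℓ · ∈ P)).card := by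
    refine ⟨W.image ℓ, ?_⟩
    rw [Finset.filter_true_of_mem fun x hx => Finset.mem_image_of_mem ℓ hx]
    omega
  obtain ⟨P, hP, hmin⟩ := WellFounded.has_min (wellFounded_lt (α := Finset β))
    {P | W.card ≤ 3 * (W.filter (ℓ · ∈ P)).card} hex
  by_cases hle : 3 * (W.filter (ℓ · ∈ P)).card ≤ 2 * W.card
  · exact ⟨P, hP, hle⟩
  obtain ⟨b, hb⟩ : P.Nonempty := by
    rw [Finset.nonempty_iff_ne_empty]
    rintro rfl
    simp at hle
  have herase := hmin (P.erase b)
  have hsplit : (W.filter (ℓ · ∈ P)).card ≤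
      (W.filter (ℓ · ∈ P.erase b)).card + (W.filter (ℓ · = b)).card := by
    refine (Finset.card_le_card fun x hx => ?_).trans (Finset.card_union_le _ _)
    simp only [Finset.mem_union, Finset.mem_filter, Finset.mem_erase] at hx ⊢
    tauto
  have hlt : 3 * (W.filter (ℓ · ∈ P.erase b)).card < W.card := by
    by_contra! hge
    exact herase hge (Finset.erase_ssubset hb)
  have hhalf := h b
  exact ⟨{b}, by simp only [Finset.mem_singleton]; omega,
    by simp only [Finset.mem_singleton]; omega⟩

/-- If every component of `G ∖ X` contains at most half of `W`, then `W` splits into two parts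
separated by `X`, each of size at most two thirds of `W`. -/
lemma exists_partition_separatesSet [Finite V] {G : SimpleGraph V} {W X : Set V}
    (hW : 2 ≤ W.ncard) (hX : ∀ v, v ∉ X → 2 * (W ∩ compAvoid G X v).ncard ≤ W.ncard) :
    ∃ A B : Set V, A ∪ B = W ∧ Disjoint A B ∧ 3 * A.ncard ≤ 2 * W.ncard ∧
      3 * B.ncard ≤ 2 * W.ncard ∧ SeparatesSet G A B X := by
  classical
  have := Fintype.ofFinite V
  let ℓ : V → V ⊕ Set V := fun v => if v ∈ X then .inl v else .inr (compAvoid G X v)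
  have hcard : W.toFinset.card = W.ncard := (Set.ncard_eq_toFinset_card' W).symm
  have hfib : ∀ b, 2 * (W.toFinset.filter (ℓ · = b)).card ≤ W.toFinset.card := by
    intro b
    rw [hcard]
    rcases (W.toFinset.filter (ℓ · = b)).eq_empty_or_nonempty with h | ⟨v, hv⟩
    · simp [h]
    obtain ⟨-, rfl⟩ := Finset.mem_filter.1 hv
    by_cases hvX : v ∈ X
    · have : (W.toFinset.filter (ℓ · = ℓ v)).card ≤ 1 := by
        rw [← Finset.card_singleton v]
        refine Finset.card_le_card fun w hw => ?_
        have h := (Finset.mem_filter.1 hw).2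
        by_cases hwX : w ∈ X <;> simp_all [ℓ]
      omega
    · refine le_trans ?_ (hX v hvX)
      rw [← Set.ncard_coe_finset]
      gcongr
      · exact Set.toFinite _
      intro w hw
      obtain ⟨hwW, h⟩ := Finset.mem_filter.1 (Finset.mem_coe.1 hw)
      refine ⟨by simpa using hwW, ?_⟩
      by_cases hwX : w ∈ X
      · simp [ℓ, hwX, hvX] at h
      · have h' : compAvoid G X w = compAvoid G X v := by simpa [ℓ, hwX, hvX] using h
        exact h' ▸ ReachAvoid.refl hwX
  obtain ⟨P, h₁, h₂⟩ := W.toFinset.exists_card_filter_mem_between_thirds ℓ hfib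
  have hsum := Finset.card_filter_add_card_filter_not (s := W.toFinset) (ℓ · ∈ P)
  refine ⟨↑(W.toFinset.filter (ℓ · ∈ P)), ↑(W.toFinset.filter (ℓ · ∉ P)), ?_, ?_, ?_, ?_, ?_⟩
  · ext x
    by_cases hx : ℓ x ∈ P <;> simp [hx]
  · rw [Finset.disjoint_coe]
    exact Finset.disjoint_filter_filter_not _ _ _
  · rw [Set.ncard_coe_finset]; omega
  · rw [Set.ncard_coe_finset]; omega
  · intro a ha b hb p
    by_contra! hp
    have haX := hp a p.start_mem_support
    have hbX := hp b p.end_mem_support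
    have hab : ℓ a = ℓ b := by simp [ℓ, haX, hbX, compAvoid_eq_of_reachAvoid ⟨p, hp⟩]
    have ha' := (Finset.mem_filter.1 (Finset.mem_coe.1 ha)).2
    exact (Finset.mem_filter.1 (Finset.mem_coe.1 hb)).2 (hab ▸ ha')

/-- If `tw(G) ≤ k` and `W` is a `δ`-sample for `𝓕_{k+1}` with
`|W| ≥ 6(k+1)` and `δ ≤ 1/24`, then (i) `W` can be partitioned into `A`, `B` of size at most
`(2/3)|W|` each, such that every minimal separator of `A` and `B` has at most `k+1` elements,
and (ii) for any such partition and any separator `S` of `A` and `B` with `|S| ≤ k+1`,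
`max(|A ∖ S|, |B ∖ S|) ≤ (4/5)|W ∖ S|`. -/
theorem dsample_balanced_partition [Fintype V] (G : SimpleGraph V) (k : ℕ)
    (htw : HasTreewidthLE G k) (δ : ℝ) (hδ : δ ≤ 1 / 24)
    (W : Set V) (hWsample : IsDeltaSample G (k + 1) δ W)
    (hWcard : 6 * (k + 1) ≤ W.ncard) :
    (∃ A B : Set V, A ∪ B = W ∧ Disjoint A B ∧
        (A.ncard : ℝ) ≤ (2 / 3) * (W.ncard : ℝ) ∧ (B.ncard : ℝ) ≤ (2 / 3) * (W.ncard : ℝ) ∧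
        ∀ S : Set V, IsMinSepSet G A B S → S.ncard ≤ k + 1) ∧
      (∀ A B : Set V, A ∪ B = W → Disjoint A B →
        (A.ncard : ℝ) ≤ (2 / 3) * (W.ncard : ℝ) → (B.ncard : ℝ) ≤ (2 / 3) * (W.ncard : ℝ) →
        ∀ S : Set V, SeparatesSet G A B S → S.ncard ≤ k + 1 →
          max ((A \ S).ncard : ℝ) ((B \ S).ncard : ℝ) ≤ (4 / 5) * ((W \ S).ncard : ℝ)) := by
  refine ⟨?_, ?_⟩
  · obtain ⟨X, hXcard, hX⟩ := htw.exists_balanced_separator W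
    obtain ⟨A, B, hAB, hdisj, hA, hB, hsep⟩ :=
      exists_partition_separatesSet (by omega : 2 ≤ W.ncard) hX
    have hA' : (3 * A.ncard : ℝ) ≤ 2 * W.ncard := by exact_mod_cast hA
    have hB' : (3 * B.ncard : ℝ) ≤ 2 * W.ncard := by exact_mod_cast hB
    exact ⟨A, B, hAB, hdisj, by linarith, by linarith, fun S hS => (hS.2 X hsep).trans hXcard⟩
  · intro A B _ _ hA hB S _ hS
    have hW : 5 * W.ncard ≤ 6 * (W \ S).ncard := by
      have := Set.ncard_le_ncard_sdiff_add_ncard W S (Set.toFinite S)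
      omega
    have hW' : (5 * W.ncard : ℝ) ≤ 6 * (W \ S).ncard := by exact_mod_cast hW
    have hAS : ((A \ S).ncard : ℝ) ≤ A.ncard := by
      exact_mod_cast Set.ncard_le_ncard Set.sdiff_subset (Set.toFinite A)
    have hBS : ((B \ S).ncard : ℝ) ≤ B.ncard := by
      exact_mod_cast Set.ncard_le_ncard Set.sdiff_subset (Set.toFinite B)
    exact max_le (by linarith) (by linarith)
end
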